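/- Let f : ℤ → ℕ be finitely supported and k ≥ 1. Then V(γₖ f) − V(γ_{k+1} f) = k · Σ_{h ≥ 1} n_{k,h}(f); that is, the volume lost when passing from the opening by a segment of length k to the opening by a segment of length k+1 equals k times the total number, over all elevations h, of runs of S_h(f) of cardinality exactly k. -/

import Mathlib

namespace Granulo

/-- Opening of a one-dimensional DEM `f` by a segment of length `k` (closed form):
`(γₖ f)(x) = max{ min{ f(y) : a ≤ y ≤ a+k−1 } : a ≤ x ≤ a+k−1 }`. -/
noncomputable def opening (k : ℕ) (f : ℤ → ℕ) (x : ℤ) : ℕ :=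
  sSup {m : ℕ | ∃ a : ℤ, a ≤ x ∧ x ≤ a + (k : ℤ) - 1 ∧
    m = sInf {n : ℕ | ∃ y : ℤ, a ≤ y ∧ y ≤ a + (k : ℤ) - 1 ∧ n = f y}}

/-- Volume of a one-dimensional DEM. -/
noncomputable def vol (f : ℤ → ℕ) : ℕ := ∑ᶠ x : ℤ, f x

/-- Level set `S_h(f) = {x : f x ≥ h}`. -/
def levelSet (h : ℕ) (f : ℤ → ℕ) : Set ℤ := {x : ℤ | h ≤ f x}

/-- A set of consecutive integers. -/
def IsInterval (R : Set ℤ) : Prop :=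
  ∀ a ∈ R, ∀ b ∈ R, ∀ c : ℤ, a ≤ c → c ≤ b → c ∈ R

/-- `R` is a run of `S`: a maximal nonempty set of consecutive integers contained in `S`. -/
def IsRun (S R : Set ℤ) : Prop :=
  R.Nonempty ∧ R ⊆ S ∧ IsInterval R ∧
    ∀ R' : Set ℤ, R ⊆ R' → R' ⊆ S → IsInterval R' → R' = R

/-- `n_{t,h}(f)`: number of runs of `S_h(f)` of cardinality `t`. -/
noncomputable def runCount (f : ℤ → ℕ) (t h : ℕ) : ℕ :=
  {R : Set ℤ | IsRun (levelSet h f) R ∧ R.ncard = t}.ncard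

/-- Granulometric probability `p_k(f) = (V(γₖ f) − V(γ_{k+1} f))/V(f)`. -/
noncomputable def p (k : ℕ) (f : ℤ → ℕ) : ℝ :=
  ((vol (opening k f) : ℝ) - (vol (opening (k+1) f) : ℝ)) / (vol f : ℝ)

/-- Granulometric index `GI(f) = −Σ_{k≥1} p_k log p_k` (terms with `p_k = 0` are `0`). -/
noncomputable def gi (f : ℤ → ℕ) : ℝ :=
  -∑ᶠ k ∈ Set.Ici (1 : ℕ), p k f * Real.log (p k f)

/-- Volume of a two-dimensional DEM. -/
noncomputable def vol2 (f : ℤ × ℤ → ℕ) : ℕ := ∑ᶠ q : ℤ × ℤ, f q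

/-- Horizontal opening: apply `γₖ` to each row `i ↦ f (i, ·)`. -/
noncomputable def hOpening (k : ℕ) (f : ℤ × ℤ → ℕ) : ℤ × ℤ → ℕ :=
  fun q => opening k (fun j => f (q.1, j)) q.2

/-- Row-wise run count `n_{t,h}^{(i)}(f)`. -/
noncomputable def rowRunCount (f : ℤ × ℤ → ℕ) (i : ℤ) (t h : ℕ) : ℕ :=
  runCount (fun j => f (i, j)) t h

/-- Granulometric probability w.r.t. horizontal openings. -/
noncomputable def p2 (k : ℕ) (f : ℤ × ℤ → ℕ) : ℝ :=
  ((vol2 (hOpening k f) : ℝ) - (vol2 (hOpening (k+1) f) : ℝ)) / (vol2 f : ℝ)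

/-- Granulometric index w.r.t. horizontal openings. -/
noncomputable def gi2 (f : ℤ × ℤ → ℕ) : ℝ :=
  -∑ᶠ k ∈ Set.Ici (1 : ℕ), p2 k f * Real.log (p2 k f)


/-- The opening of a subset `S` of `ℤ` by a segment of length `k`: the union of the segments of
length `k` contained in `S`. -/
def setOpening (k : ℕ) (S : Set ℤ) : Set ℤ :=
  {x | ∃ a : ℤ, a ≤ x ∧ x ≤ a + (k : ℤ) - 1 ∧ ∀ y, a ≤ y → y ≤ a + (k : ℤ) - 1 → y ∈ S}

/-- The left endpoints of the runs of `S` of cardinality `k`. -/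
def runStarts (k : ℕ) (S : Set ℤ) : Set ℤ :=
  {a | (∀ y, a ≤ y → y ≤ a + (k : ℤ) - 1 → y ∈ S) ∧ a - 1 ∉ S ∧ a + (k : ℤ) ∉ S}

theorem le_opening_iff (f : ℤ → ℕ) {k : ℕ} (hk : 1 ≤ k) (h : ℕ) (x : ℤ) :
    h ≤ opening k f x ↔ x ∈ setOpening k (levelSet h f) := by
  have hbdd : ∀ m ∈ {m : ℕ | ∃ a : ℤ, a ≤ x ∧ x ≤ a + (k : ℤ) - 1 ∧
      m = sInf {n : ℕ | ∃ y : ℤ, a ≤ y ∧ y ≤ a + (k : ℤ) - 1 ∧ n = f y}}, m ≤ f x := by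
    rintro m ⟨a, h1, h2, rfl⟩
    exact Nat.sInf_le ⟨x, h1, h2, rfl⟩
  constructor
  · intro hle
    obtain ⟨a, h1, h2, h3⟩ := Nat.sSup_mem (s := {m : ℕ | ∃ a : ℤ, a ≤ x ∧ x ≤ a + (k : ℤ) - 1 ∧
      m = sInf {n : ℕ | ∃ y : ℤ, a ≤ y ∧ y ≤ a + (k : ℤ) - 1 ∧ n = f y}})
      ⟨_, x, le_rfl, by omega, rfl⟩ ⟨f x, hbdd⟩
    refine ⟨a, h1, h2, fun y hy1 hy2 => ?_⟩
    refine le_trans hle ?_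
    rw [opening, h3]
    exact Nat.sInf_le ⟨y, hy1, hy2, rfl⟩
  · rintro ⟨a, h1, h2, h3⟩
    refine le_trans ?_ (le_csSup ⟨f x, hbdd⟩ ⟨a, h1, h2, rfl⟩)
    refine le_csInf ⟨_, x, h1, h2, rfl⟩ ?_
    rintro n ⟨y, hy1, hy2, rfl⟩
    exact h3 y hy1 hy2

theorem levelSet_opening (f : ℤ → ℕ) {k : ℕ} (hk : 1 ≤ k) (h : ℕ) :
    levelSet h (opening k f) = setOpening k (levelSet h f) :=
  Set.ext fun x => le_opening_iff f hk h x

theorem setOpening_subset (k : ℕ) (S : Set ℤ) : setOpening k S ⊆ S :=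
  fun x ⟨_, h1, h2, h3⟩ => h3 x h1 h2

theorem setOpening_succ_subset {k : ℕ} (hk : 1 ≤ k) (S : Set ℤ) :
    setOpening (k + 1) S ⊆ setOpening k S := by
  rintro x ⟨a, h1, h2, h3⟩
  push_cast at h2 h3
  by_cases hx : x = a + k
  · exact ⟨a + 1, by omega, by omega, fun y _ _ => h3 y (by omega) (by omega)⟩
  · exact ⟨a, h1, by omega, fun y _ _ => h3 y (by omega) (by omega)⟩

theorem opening_le (f : ℤ → ℕ) {k : ℕ} (hk : 1 ≤ k) (x : ℤ) : opening k f x ≤ f x :=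
  setOpening_subset k _ ((le_opening_iff f hk _ x).1 le_rfl)

theorem setOpening_diff_setOpening_succ (k : ℕ) (S : Set ℤ) :
    setOpening k S \ setOpening (k + 1) S =
      (fun q : ℤ × ℤ => q.1 + q.2) '' (runStarts k S ×ˢ Set.Ico (0 : ℤ) k) := by
  ext x
  simp only [Set.mem_image, Set.mem_prod, Set.mem_Ico, Prod.exists]
  constructor
  · rintro ⟨⟨a, h1, h2, h3⟩, hx⟩
    refine ⟨a, x - a, ⟨⟨h3, fun ha => hx ?_, fun ha => hx ?_⟩, by omega, by omega⟩, by omega⟩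
    · refine ⟨a - 1, by omega, by push_cast; omega, fun y hy1 hy2 => ?_⟩
      push_cast at hy2
      obtain rfl | hy : y = a - 1 ∨ a ≤ y := by omega
      · exact ha
      · exact h3 y hy (by omega)
    · refine ⟨a, by omega, by push_cast; omega, fun y hy1 hy2 => ?_⟩
      push_cast at hy2
      obtain rfl | hy : y = a + k ∨ y ≤ a + k - 1 := by omega
      · exact ha
      · exact h3 y hy1 hy
  · rintro ⟨a, i, ⟨⟨h3, hl, hr⟩, hi0, hik⟩, rfl⟩
    refine ⟨⟨a, by omega, by omega, h3⟩, ?_⟩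
    rintro ⟨b, hb1, hb2, hb⟩
    push_cast at hb2 hb
    by_cases hba : b ≤ a - 1
    · exact hl (hb _ hba (by omega))
    · exact hr (hb _ (by omega) (by omega))

theorem injOn_add_runStarts (k : ℕ) (S : Set ℤ) :
    Set.InjOn (fun q : ℤ × ℤ => q.1 + q.2) (runStarts k S ×ˢ Set.Ico (0 : ℤ) k) := by
  rintro ⟨a, i⟩ ⟨⟨ha, hal, -⟩, hi0, hik⟩ ⟨b, j⟩ ⟨⟨hb, hbl, -⟩, hj0, hjk⟩ hab
  simp only at *
  obtain hlt | rfl | hlt := lt_trichotomy a b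
  · exact absurd (ha (b - 1) (by omega) (by omega)) hbl
  · exact Prod.ext rfl (by simpa using hab)
  · exact absurd (hb (a - 1) (by omega) (by omega)) hal

theorem ncard_setOpening_eq {k : ℕ} (hk : 1 ≤ k) {S : Set ℤ} (hS : S.Finite) :
    (setOpening k S).ncard = (setOpening (k + 1) S).ncard + k * (runStarts k S).ncard := by
  have hfin : (setOpening (k + 1) S).Finite := hS.subset (setOpening_subset _ _)
  rw [← Set.ncard_sdiff_add_ncard_of_subset (setOpening_succ_subset hk S)
    (hS.subset (setOpening_subset _ _)), setOpening_diff_setOpening_succ,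
    (injOn_add_runStarts k S).ncard_image, Set.ncard_prod]
  have : (Set.Ico (0 : ℤ) k).ncard = k := by
    rw [← Finset.coe_Ico, Set.ncard_coe_finset]; simp
  rw [this]
  ring

theorem ncard_Icc_int (a b : ℤ) : (Set.Icc a b).ncard = (b + 1 - a).toNat := by
  rw [← Finset.coe_Icc, Set.ncard_coe_finset, Int.card_Icc]

theorem isInterval_Icc (a b : ℤ) : IsInterval (Set.Icc a b) :=
  fun _ hx _ hy _ h1 h2 => ⟨hx.1.trans h1, h2.trans hy.2⟩

theorem IsInterval.eq_Icc {R : Set ℤ} (hR : IsInterval R) (hne : R.Nonempty) (hfin : R.Finite) :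
    ∃ a b, a ≤ b ∧ R = Set.Icc a b := by
  obtain ⟨a, ha, hmin⟩ := Set.exists_min_image R id hfin hne
  obtain ⟨b, hb, hmax⟩ := Set.exists_max_image R id hfin hne
  exact ⟨a, b, hmin b hb, Set.Subset.antisymm (fun x hx => ⟨hmin x hx, hmax x hx⟩)
    fun x hx => hR a ha b hb x hx.1 hx.2⟩

theorem isRun_Icc_iff {S : Set ℤ} {a b : ℤ} (hab : a ≤ b) :
    IsRun S (Set.Icc a b) ↔ Set.Icc a b ⊆ S ∧ a - 1 ∉ S ∧ b + 1 ∉ S := by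
  constructor
  · rintro ⟨-, hsub, -, hmax⟩
    refine ⟨hsub, fun h => ?_, fun h => ?_⟩
    · have := hmax (Set.Icc (a - 1) b) (Set.Icc_subset_Icc (by omega) le_rfl)
        (fun y hy => ?_) (isInterval_Icc _ _)
      · have h' : a - 1 ∈ Set.Icc a b := this ▸ ⟨le_rfl, by omega⟩
        exact absurd h'.1 (by omega)
      · obtain rfl | hy' : y = a - 1 ∨ a ≤ y := by have := hy.1; omega
        · exact h
        · exact hsub ⟨hy', hy.2⟩
    · have := hmax (Set.Icc a (b + 1)) (Set.Icc_subset_Icc le_rfl (by omega))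
        (fun y hy => ?_) (isInterval_Icc _ _)
      · have h' : b + 1 ∈ Set.Icc a b := this ▸ ⟨by omega, le_rfl⟩
        exact absurd h'.2 (by omega)
      · obtain rfl | hy' : y = b + 1 ∨ y ≤ b := by have := hy.2; omega
        · exact h
        · exact hsub ⟨hy.1, hy'⟩
  · rintro ⟨hsub, hl, hr⟩
    refine ⟨⟨a, le_rfl, hab⟩, hsub, isInterval_Icc a b, fun R' hR hS hI => ?_⟩
    refine Set.Subset.antisymm (fun z hz => ?_) hR
    constructor
    · by_contra! hza
      exact hl (hS (hI z hz a (hR ⟨le_rfl, hab⟩) _ (by omega) (by omega)))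
    · by_contra! hza
      exact hr (hS (hI b (hR ⟨hab, le_rfl⟩) z hz _ (by omega) (by omega)))

theorem setOf_isRun_eq_image {k : ℕ} (hk : 1 ≤ k) (S : Set ℤ) :
    {R : Set ℤ | IsRun S R ∧ R.ncard = k} =
      (fun a : ℤ => Set.Icc a (a + k - 1)) '' runStarts k S := by
  ext R
  constructor
  · rintro ⟨hrun, hcard⟩
    obtain ⟨a, b, hab, rfl⟩ :=
      hrun.2.2.1.eq_Icc hrun.1 (Set.finite_of_ncard_pos (by omega))
    rw [ncard_Icc_int] at hcard
    obtain rfl : b = a + k - 1 := by omega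
    obtain ⟨hsub, hl, hr⟩ := (isRun_Icc_iff hab).1 hrun
    exact ⟨a, ⟨fun y h1 h2 => hsub ⟨h1, h2⟩, hl, by simpa using hr⟩, rfl⟩
  · rintro ⟨a, ⟨hsub, hl, hr⟩, rfl⟩
    refine ⟨(isRun_Icc_iff (by omega)).2 ⟨fun y hy => hsub y hy.1 hy.2, hl, by simpa using hr⟩, ?_⟩
    rw [ncard_Icc_int]
    omega

theorem runCount_eq (f : ℤ → ℕ) {k : ℕ} (hk : 1 ≤ k) (h : ℕ) :
    runCount f k h = (runStarts k (levelSet h f)).ncard := by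
  rw [runCount, setOf_isRun_eq_image hk]
  refine Set.ncard_image_of_injective _ fun a b hab => ?_
  have h1 : a ∈ Set.Icc b (b + (k : ℤ) - 1) := hab ▸ ⟨le_rfl, by omega⟩
  have h2 : b ∈ Set.Icc a (a + (k : ℤ) - 1) := hab.symm ▸ ⟨le_rfl, by omega⟩
  exact le_antisymm h2.1 h1.1

theorem runCount_eq_zero {f : ℤ → ℕ} {k h : ℕ} (hk : 1 ≤ k) (hh : ∀ x, f x < h) :
    runCount f k h = 0 := by
  rw [runCount_eq f hk]
  convert Set.ncard_empty ℤ
  refine Set.eq_empty_of_forall_notMem fun a ha => ?_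
  exact (hh a).not_ge (ha.1 a le_rfl (by omega))

theorem finite_levelSet {f : ℤ → ℕ} (hf : (Function.support f).Finite) {h : ℕ} (hh : 1 ≤ h) :
    (levelSet h f).Finite :=
  hf.subset fun x (hx : h ≤ f x) => Function.mem_support.2 (by omega)

/-- The volume is the sum of the cardinalities of the level sets. -/
theorem vol_eq_sum_ncard_levelSet {f : ℤ → ℕ} (hf : (Function.support f).Finite) {N : ℕ}
    (hN : ∀ x, f x ≤ N) : vol f = ∑ h ∈ Finset.Icc 1 N, (levelSet h f).ncard := by
  have hcard : ∀ h ∈ Finset.Icc 1 N,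
      (levelSet h f).ncard = ∑ x ∈ hf.toFinset, if h ≤ f x then 1 else 0 := by
    intro h hh
    rw [← Finset.card_filter, ← Set.ncard_coe_finset]
    congr 1
    ext x
    have := (Finset.mem_Icc.1 hh).1
    simp only [levelSet, Set.mem_ofPred_eq, Finset.coe_filter, Set.Finite.mem_toFinset,
      Function.mem_support]
    omega
  rw [Finset.sum_congr rfl hcard, Finset.sum_comm, vol,
    finsum_eq_sum_of_support_subset f (s := hf.toFinset) (by simp)]
  refine Finset.sum_congr rfl fun x _ => ?_
  rw [← Finset.card_filter]
  have : (Finset.Icc 1 N).filter (· ≤ f x) = Finset.Icc 1 (f x) := by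
    ext h
    have := hN x
    simp only [Finset.mem_filter, Finset.mem_Icc]
    omega
  simp [this]

theorem vol_opening_eq_sum {f : ℤ → ℕ} (hf : (Function.support f).Finite) {N k : ℕ}
    (hN : ∀ x, f x ≤ N) (hk : 1 ≤ k) :
    vol (opening k f) = ∑ h ∈ Finset.Icc 1 N, (setOpening k (levelSet h f)).ncard := by
  have hsupp : (Function.support (opening k f)).Finite := hf.subset fun x hx => by
    have := opening_le f hk x
    rw [Function.mem_support] at hx ⊢
    omega
  simp_rw [vol_eq_sum_ncard_levelSet hsupp fun x => (opening_le f hk x).trans (hN x),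
    levelSet_opening f hk]

theorem exists_forall_le {f : ℤ → ℕ} (hf : (Function.support f).Finite) : ∃ N, ∀ x, f x ≤ N := by
  refine ⟨hf.toFinset.sup f, fun x => ?_⟩
  by_cases hx : f x = 0
  · omega
  · exact Finset.le_sup (f := f) (hf.mem_toFinset.2 hx)

/-- `V(γₖ f) − V(γ_{k+1} f) = k · Σ_{h ≥ 1} n_{k,h}(f)`. -/
theorem vol_opening_diff_eq (f : ℤ → ℕ)
    (hf : (Function.support f).Finite) (k : ℕ) (hk : 1 ≤ k) :
    (vol (opening k f) : ℤ) - (vol (opening (k+1) f) : ℤ) =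
      (k : ℤ) * ∑ᶠ h ∈ Set.Ici (1 : ℕ), (runCount f k h : ℤ) := by
  obtain ⟨N, hN⟩ := exists_forall_le hf
  have hruns : ∑ᶠ h ∈ Set.Ici (1 : ℕ), (runCount f k h : ℤ) =
      ∑ h ∈ Finset.Icc 1 N, (runCount f k h : ℤ) := by
    refine finsum_mem_eq_sum_of_inter_support_eq _ ?_
    ext h
    simp only [Set.mem_inter_iff, Set.mem_Ici, Function.mem_support, Finset.coe_Icc, Set.mem_Icc]
    refine ⟨fun ⟨h1, h2⟩ => ⟨⟨h1, ?_⟩, h2⟩, fun ⟨⟨h1, _⟩, h2⟩ => ⟨h1, h2⟩⟩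
    by_contra! hlt
    exact h2 (by rw [runCount_eq_zero hk fun x => (hN x).trans_lt hlt]; rfl)
  rw [hruns, vol_opening_eq_sum hf hN hk, vol_opening_eq_sum hf hN (Nat.le_add_left 1 k)]
  push_cast
  rw [← Finset.sum_sub_distrib, Finset.mul_sum]
  refine Finset.sum_congr rfl fun h hh => ?_
  rw [ncard_setOpening_eq hk (finite_levelSet hf (Finset.mem_Icc.1 hh).1), runCount_eq f hk]
  push_cast
  ring

end Granulo
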